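/- arXiv:2212.11216 — 7 statements merged into one kernel-verified Lean document; each statement's English description precedes it below -/
import Mathlib

section
/- For every k ≥ 2, any polygonal chain with 2 links in ℝ^k contains at most 3 distinct points of the vertex set H(2,k) = {0,1}^k; that is, for any points S_1, S_2, S_3 ∈ ℝ^k, the set of hypercube vertices lying in [S_1,S_2] ∪ [S_2,S_3] has cardinality at most 3. -/
/-- If a hypercube vertex `v` comes strictly before another one `w` on a ray from `Q`, then `v` is
the projection of `Q` onto the cube. -/
lemma eq_clamp_of_lt_on_ray {ι : Type*} {Q d v w : ι → ℝ} {a b : ℝ} (ha : 0 ≤ a) (hab : a < b)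
    (hv : ∀ i, v i = 0 ∨ v i = 1) (hw : ∀ i, w i = 0 ∨ w i = 1)
    (hva : ∀ i, v i = Q i + a * d i) (hwb : ∀ i, w i = Q i + b * d i) :
    v = fun i => max 0 (min 1 (Q i)) := by
  funext i
  have h₁ := hva i
  have h₂ := hwb i
  rcases lt_trichotomy (d i) 0 with hd | hd | hd
  · have hlt : w i < v i := by nlinarith
    have hv1 : v i = 1 := by
      rcases hv i with h | h <;> rcases hw i with h' | h' <;> linarith
    have hQ : 1 ≤ Q i := by nlinarith
    simp [hv1, hQ]
  · have hQ : Q i = v i := by rw [h₁, hd]; ring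
    rcases hv i with h | h <;> simp [hQ, h]
  · have hlt : v i < w i := by nlinarith
    have hv0 : v i = 0 := by
      rcases hv i with h | h <;> rcases hw i with h' | h' <;> linarith
    have hQ : Q i ≤ 0 := by nlinarith
    simp [hv0, hQ]

/-- A segment ending at `Q` contains at most one hypercube vertex other than the projection of `Q`
onto the cube. -/
lemma subsingleton_vertices_segment_ne_clamp {ι : Type*} (P Q : ι → ℝ) :
    {v : ι → ℝ | (∀ i, v i = 0 ∨ v i = 1) ∧ v ∈ segment ℝ Q P ∧
      v ≠ fun i => max 0 (min 1 (Q i))}.Subsingleton := by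
  rintro v ⟨hv, hvs, hvQ⟩ w ⟨hw, hws, hwQ⟩
  rw [segment_eq_image'] at hvs hws
  obtain ⟨a, ha, hva⟩ := hvs
  obtain ⟨b, hb, hwb⟩ := hws
  have hva' : ∀ i, v i = Q i + a * (P - Q) i := fun i => by simp [← hva]
  have hwb' : ∀ i, w i = Q i + b * (P - Q) i := fun i => by simp [← hwb]
  rcases lt_trichotomy a b with h | h | h
  · exact absurd (eq_clamp_of_lt_on_ray ha.1 h hv hw hva' hwb') hvQ
  · rw [← hva, ← hwb, h]
  · exact absurd (eq_clamp_of_lt_on_ray hb.1 h hw hv hwb' hva') hwQ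

/-- For every `k ≥ 2`, a polygonal chain with 2 links in `ℝ^k` contains at most
3 distinct vertices of the unit hypercube `{0,1}^k`. -/
theorem two_link_chain_covers_at_most_three_vertices (k : ℕ) (hk : 2 ≤ k)
    (S₁ S₂ S₃ : Fin k → ℝ) :
    {v : Fin k → ℝ | (∀ i, v i = 0 ∨ v i = 1) ∧
      v ∈ segment ℝ S₁ S₂ ∪ segment ℝ S₂ S₃}.ncard ≤ 3 := by
  have hA := subsingleton_vertices_segment_ne_clamp S₁ S₂
  have hB := subsingleton_vertices_segment_ne_clamp S₃ S₂
  set c : Fin k → ℝ := fun i => max 0 (min 1 (S₂ i))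
  set A := {v : Fin k → ℝ | (∀ i, v i = 0 ∨ v i = 1) ∧ v ∈ segment ℝ S₂ S₁ ∧ v ≠ c}
  set B := {v : Fin k → ℝ | (∀ i, v i = 0 ∨ v i = 1) ∧ v ∈ segment ℝ S₂ S₃ ∧ v ≠ c}
  have hsub : {v : Fin k → ℝ | (∀ i, v i = 0 ∨ v i = 1) ∧
      v ∈ segment ℝ S₁ S₂ ∪ segment ℝ S₂ S₃} ⊆ insert c (A ∪ B) := by
    rintro v ⟨hv, hs⟩
    rw [segment_symm ℝ S₁ S₂] at hs
    by_cases hc : v = c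
    · exact Or.inl hc
    · exact Or.inr (hs.imp (fun h => ⟨hv, h, hc⟩) (fun h => ⟨hv, h, hc⟩))
  have hA1 : A.ncard ≤ 1 :=
    have := hA.finite.to_subtype
    Set.ncard_le_one_iff_subsingleton.2 hA
  have hB1 : B.ncard ≤ 1 :=
    have := hB.finite.to_subtype
    Set.ncard_le_one_iff_subsingleton.2 hB
  have h₁ := Set.ncard_le_ncard hsub ((hA.finite.union hB.finite).insert c)
  have h₂ := Set.ncard_insert_le c (A ∪ B)
  have h₃ := Set.ncard_union_le A B
  omega
end

section
/- (Lemma 1) For every k ≥ 2, it is not possible to visit more than 4 distinct elements of the set H(2,k) = {0,1}^k ⊂ ℝ^k with a polygonal chain having 3 links; that is, for any points S_1, S_2, S_3, S_4 ∈ ℝ^k, the set of hypercube vertices lying in [S_1,S_2] ∪ [S_2,S_3] ∪ [S_3,S_4] has cardinality at most 4. -/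
/-- `v` is a vertex of the unit hypercube. -/
def IsCubeVertex {ι : Type*} (v : ι → ℝ) : Prop := ∀ i, v i = 0 ∨ v i = 1

/-- The vertices of the unit hypercube lying on the segment from `P` to `Q`. -/
def cubeVerticesOn {ι : Type*} (P Q : ι → ℝ) : Set (ι → ℝ) :=
  {v | IsCubeVertex v ∧ v ∈ segment ℝ P Q}

variable {ι : Type*}

theorem cubeVerticesOn_comm (P Q : ι → ℝ) : cubeVerticesOn P Q = cubeVerticesOn Q P := by
  simp only [cubeVerticesOn, segment_symm ℝ P Q]

theorem eq_or_eq_of_mem_cubeVerticesOn {P Q a b c : ι → ℝ} (hab : a ≠ b)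
    (ha : a ∈ cubeVerticesOn P Q) (hb : b ∈ cubeVerticesOn P Q) (hc : c ∈ cubeVerticesOn P Q) :
    c = a ∨ c = b := by
  obtain ⟨ha, hA⟩ := ha
  obtain ⟨hb, hB⟩ := hb
  obtain ⟨hc, hC⟩ := hc
  rw [segment_eq_image'] at hA hB hC
  obtain ⟨x, -, rfl⟩ := hA
  obtain ⟨y, -, rfl⟩ := hB
  obtain ⟨z, -, rfl⟩ := hC
  obtain ⟨i, hi⟩ := Function.ne_iff.1 hab
  have h : (P + z • (Q - P)) i = (P + x • (Q - P)) i ∨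
      (P + z • (Q - P)) i = (P + y • (Q - P)) i := by
    rcases ha i with h₁ | h₁ <;> rcases hb i with h₂ | h₂ <;> rcases hc i with h₃ | h₃ <;>
      simp_all only [ne_eq, not_true_eq_false, or_true, true_or]
  have hne : Q i - P i ≠ 0 := by
    intro h₀
    simp [h₀] at hi
  simp only [Pi.add_apply, Pi.smul_apply, Pi.sub_apply, smul_eq_mul, add_right_inj,
    mul_eq_mul_right_iff, hne, or_false] at h
  rcases h with rfl | rfl
  · exact Or.inl rfl
  · exact Or.inr rfl

theorem cubeVerticesOn_encard_le_two (P Q : ι → ℝ) : (cubeVerticesOn P Q).encard ≤ 2 := by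
  by_contra! h
  obtain ⟨T, hT, hcard⟩ := Set.exists_subset_encard_eq (k := 3) (Order.add_one_le_of_lt h)
  obtain ⟨a, b, c, hab, hac, hbc, rfl⟩ := Set.encard_eq_three.1 hcard
  rcases eq_or_eq_of_mem_cubeVerticesOn hab (hT (by simp)) (hT (by simp))
    (hT (show c ∈ _ by simp)) with rfl | rfl
  · exact hac rfl
  · exact hbc rfl

theorem cubeVerticesOn_finite (P Q : ι → ℝ) : (cubeVerticesOn P Q).Finite :=
  Set.finite_of_encard_le_coe (k := 2) (cubeVerticesOn_encard_le_two P Q)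

theorem cubeVerticesOn_ncard_le_two (P Q : ι → ℝ) : (cubeVerticesOn P Q).ncard ≤ 2 := by
  have h := cubeVerticesOn_encard_le_two P Q
  rw [← (cubeVerticesOn_finite P Q).cast_ncard_eq] at h
  exact_mod_cast h

theorem exists_right_eq_add_smul_of_mem_segment {P Q a b : ι → ℝ} (hab : a ≠ b)
    (ha : a ∈ segment ℝ P Q) (hb : b ∈ segment ℝ P Q) :
    (∃ t : ℝ, 0 ≤ t ∧ Q = b + t • (b - a)) ∨ ∃ t : ℝ, 0 ≤ t ∧ Q = a + t • (a - b) := by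
  rw [segment_eq_image'] at ha hb
  obtain ⟨x, hx, rfl⟩ := ha
  obtain ⟨y, hy, rfl⟩ := hb
  have hxy : x ≠ y := fun h => hab (by rw [h])
  rcases lt_or_gt_of_ne hxy with h | h
  · refine Or.inl ⟨(1 - y) / (y - x), div_nonneg (by linarith [hy.2]) (by linarith), ?_⟩
    have : y - x ≠ 0 := by linarith
    ext i
    simp only [Pi.add_apply, Pi.smul_apply, Pi.sub_apply, smul_eq_mul]
    field_simp
    ring
  · refine Or.inr ⟨(1 - x) / (x - y), div_nonneg (by linarith [hx.2]) (by linarith), ?_⟩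
    have : x - y ≠ 0 := by linarith
    ext i
    simp only [Pi.add_apply, Pi.smul_apply, Pi.sub_apply, smul_eq_mul]
    field_simp
    ring

/-- A segment with two hypercube vertices ends beyond the second of them. -/
theorem exists_right_eq_add_smul_of_ncard_eq_two {P Q : ι → ℝ}
    (h : (cubeVerticesOn P Q).ncard = 2) :
    ∃ a b : ι → ℝ, a ∈ cubeVerticesOn P Q ∧ b ∈ cubeVerticesOn P Q ∧
      ∃ t : ℝ, 0 ≤ t ∧ Q = b + t • (b - a) := by
  obtain ⟨a, b, hab, hs⟩ := Set.ncard_eq_two.1 h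
  have ha : a ∈ cubeVerticesOn P Q := by simp [hs]
  have hb : b ∈ cubeVerticesOn P Q := by simp [hs]
  rcases exists_right_eq_add_smul_of_mem_segment hab ha.2 hb.2 with h | h
  · exact ⟨a, b, ha, hb, h⟩
  · exact ⟨b, a, hb, ha, h⟩

theorem IsCubeVertex.eq_of_add_smul_eq {a b c d : ι → ℝ} (ha : IsCubeVertex a)
    (hb : IsCubeVertex b) (hc : IsCubeVertex c) (hd : IsCubeVertex d) {t s : ℝ} (ht : 0 ≤ t)
    (hs : 0 ≤ s) (h : b + t • (b - a) = d + s • (d - c)) : b = d := by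
  ext i
  have hi := congrFun h i
  simp only [Pi.add_apply, Pi.smul_apply, Pi.sub_apply, smul_eq_mul] at hi
  rcases ha i with h₁ | h₁ <;> rcases hb i with h₂ | h₂ <;> rcases hc i with h₃ | h₃ <;>
    rcases hd i with h₄ | h₄ <;> rw [h₁, h₂, h₃, h₄] at hi <;> rw [h₂, h₄] <;> linarith

/-- Two consecutive links with two hypercube vertices each share one of them. -/
theorem cubeVerticesOn_inter_nonempty {P Q R : ι → ℝ} (h₁ : (cubeVerticesOn P Q).ncard = 2)
    (h₂ : (cubeVerticesOn Q R).ncard = 2) :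
    (cubeVerticesOn P Q ∩ cubeVerticesOn Q R).Nonempty := by
  rw [cubeVerticesOn_comm Q R] at h₂ ⊢
  obtain ⟨a, b, ha, hb, t, ht, hQ⟩ := exists_right_eq_add_smul_of_ncard_eq_two h₁
  obtain ⟨c, d, hc, hd, s, hs, hQ'⟩ := exists_right_eq_add_smul_of_ncard_eq_two h₂
  have := ha.1.eq_of_add_smul_eq hb.1 hc.1 hd.1 ht hs (hQ.symm.trans hQ')
  exact ⟨b, hb, this ▸ hd⟩

/-- If a vertex `e` lies between a point beyond `b` on the ray from `a` and a point beyond `d` on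
the ray from `c`, then the five vertices are not distinct. -/
theorem IsCubeVertex.eq_of_mem_segment_add_smul {a b c d e : ι → ℝ} (ha : IsCubeVertex a)
    (hb : IsCubeVertex b) (hc : IsCubeVertex c) (hd : IsCubeVertex d) (he : IsCubeVertex e)
    {t s : ℝ} (ht : 0 ≤ t) (hs : 0 ≤ s)
    (h : e ∈ segment ℝ (b + t • (b - a)) (d + s • (d - c))) :
    e = b ∨ e = d ∨ a = c ∨ a = d ∨ b = c := by
  obtain ⟨m, l, hm, hl, hml, h⟩ := h
  obtain ⟨q, hq⟩ : ∃ q, q = m * t := ⟨_, rfl⟩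
  obtain ⟨p, hp⟩ : ∃ p, p = l * s := ⟨_, rfl⟩
  have hq₀ : 0 ≤ q := hq ▸ mul_nonneg hm ht
  have hp₀ : 0 ≤ p := hp ▸ mul_nonneg hl hs
  have key : ∀ i, m * b i + q * (b i - a i) + (l * d i + p * (d i - c i)) = e i := by
    intro i
    rw [← h, hq, hp]
    simp only [Pi.add_apply, Pi.smul_apply, Pi.sub_apply, smul_eq_mul]
    ring
  by_contra! hne
  obtain ⟨heb, hed, hac, had, hbc⟩ := hne
  have hl₀ : 0 < l := by
    refine lt_of_le_of_ne hl fun h₀ => heb ?_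
    subst h₀
    rw [zero_mul] at hp
    ext i
    have hi := key i
    rcases ha i with h₁ | h₁ <;> rcases hb i with h₂ | h₂ <;> rcases he i with h₅ | h₅ <;>
      rw [h₁, h₂, h₅, hp] at hi <;> rw [h₂, h₅] <;> linarith
  have hm₀ : 0 < m := by
    refine lt_of_le_of_ne hm fun h₀ => hed ?_
    subst h₀
    rw [zero_mul] at hq
    ext i
    have hi := key i
    rcases hc i with h₁ | h₁ <;> rcases hd i with h₂ | h₂ <;> rcases he i with h₅ | h₅ <;>
      rw [h₁, h₂, h₅, hq] at hi <;> rw [h₂, h₅] <;> linarith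
  have hq₁ : 0 < q := by
    refine lt_of_le_of_ne hq₀ fun h₀ => hed ?_
    ext i
    have hi := key i
    rcases hb i with h₂ | h₂ <;> rcases hc i with h₃ | h₃ <;> rcases hd i with h₄ | h₄ <;>
      rcases he i with h₅ | h₅ <;> rw [h₂, h₃, h₄, h₅, ← h₀] at hi <;> rw [h₄, h₅] <;> linarith
  have hp₁ : 0 < p := by
    refine lt_of_le_of_ne hp₀ fun h₀ => heb ?_
    ext i
    have hi := key i
    rcases ha i with h₁ | h₁ <;> rcases hb i with h₂ | h₂ <;> rcases hd i with h₄ | h₄ <;>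
      rcases he i with h₅ | h₅ <;> rw [h₁, h₂, h₄, h₅, ← h₀] at hi <;> rw [h₂, h₅] <;> linarith
  have hlp : l + p = 1 := by
    obtain ⟨i, hi⟩ := Function.ne_iff.1 had
    have hk := key i
    rcases ha i with h₁ | h₁ <;> rcases hb i with h₂ | h₂ <;> rcases hc i with h₃ | h₃ <;>
      rcases hd i with h₄ | h₄ <;> rcases he i with h₅ | h₅ <;>
      rw [h₁, h₂, h₃, h₄, h₅] at hk <;> rw [h₁, h₄] at hi <;>
      first | exact absurd rfl hi | linarith
  have hmq : m + q = 1 := by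
    obtain ⟨i, hi⟩ := Function.ne_iff.1 hbc
    have hk := key i
    rcases ha i with h₁ | h₁ <;> rcases hb i with h₂ | h₂ <;> rcases hc i with h₃ | h₃ <;>
      rcases hd i with h₄ | h₄ <;> rcases he i with h₅ | h₅ <;>
      rw [h₁, h₂, h₃, h₄, h₅] at hk <;> rw [h₂, h₃] at hi <;>
      first | exact absurd rfl hi | linarith
  obtain ⟨i, hi⟩ := Function.ne_iff.1 hac
  have hk := key i
  rcases ha i with h₁ | h₁ <;> rcases hb i with h₂ | h₂ <;> rcases hc i with h₃ | h₃ <;>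
    rcases hd i with h₄ | h₄ <;> rcases he i with h₅ | h₅ <;>
    rw [h₁, h₂, h₃, h₄, h₅] at hk <;> rw [h₁, h₃] at hi <;>
    first | exact absurd rfl hi | linarith

theorem cubeVerticesOn_chain_inter_nonempty {S₁ S₂ S₃ S₄ : ι → ℝ}
    (h₁ : (cubeVerticesOn S₁ S₂).ncard = 2) (h₂ : (cubeVerticesOn S₂ S₃).Nonempty)
    (h₃ : (cubeVerticesOn S₃ S₄).ncard = 2) :
    (cubeVerticesOn S₁ S₂ ∩ cubeVerticesOn S₂ S₃).Nonempty ∨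
      (cubeVerticesOn S₂ S₃ ∩ cubeVerticesOn S₃ S₄).Nonempty ∨
      (cubeVerticesOn S₁ S₂ ∩ cubeVerticesOn S₃ S₄).Nonempty := by
  rw [cubeVerticesOn_comm S₃ S₄] at h₃ ⊢
  obtain ⟨a, b, ha, hb, t, ht, hS₂⟩ := exists_right_eq_add_smul_of_ncard_eq_two h₁
  obtain ⟨c, d, hc, hd, s, hs, hS₃⟩ := exists_right_eq_add_smul_of_ncard_eq_two h₃
  obtain ⟨e, he⟩ := h₂
  have h := he.2
  rw [hS₂, hS₃] at h
  rcases ha.1.eq_of_mem_segment_add_smul hb.1 hc.1 hd.1 he.1 ht hs h with h | h | h | h | h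
  · exact Or.inl ⟨b, hb, h ▸ he⟩
  · exact Or.inr (Or.inl ⟨d, h ▸ he, hd⟩)
  · exact Or.inr (Or.inr ⟨a, ha, h ▸ hc⟩)
  · exact Or.inr (Or.inr ⟨a, ha, h ▸ hd⟩)
  · exact Or.inr (Or.inr ⟨b, hb, h ▸ hc⟩)

/-- (Lemma 1) For every `k ≥ 2`, a polygonal chain with 3 links in `ℝ^k`
contains at most 4 distinct vertices of the unit hypercube `{0,1}^k`. -/
theorem three_link_chain_covers_at_most_four_vertices (k : ℕ) (hk : 2 ≤ k)
    (S₁ S₂ S₃ S₄ : Fin k → ℝ) :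
    {v : Fin k → ℝ | (∀ i, v i = 0 ∨ v i = 1) ∧
      v ∈ segment ℝ S₁ S₂ ∪ segment ℝ S₂ S₃ ∪ segment ℝ S₃ S₄}.ncard ≤ 4 := by
  have hV : {v : Fin k → ℝ | (∀ i, v i = 0 ∨ v i = 1) ∧
      v ∈ segment ℝ S₁ S₂ ∪ segment ℝ S₂ S₃ ∪ segment ℝ S₃ S₄} =
      cubeVerticesOn S₁ S₂ ∪ cubeVerticesOn S₂ S₃ ∪ cubeVerticesOn S₃ S₄ := by
    ext v
    simp only [cubeVerticesOn, IsCubeVertex, Set.mem_union, Set.mem_ofPred_eq]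
    tauto
  rw [hV]
  have hA := cubeVerticesOn_ncard_le_two S₁ S₂
  have hB := cubeVerticesOn_ncard_le_two S₂ S₃
  have hC := cubeVerticesOn_ncard_le_two S₃ S₄
  have fA := cubeVerticesOn_finite S₁ S₂
  have fB := cubeVerticesOn_finite S₂ S₃
  have fC := cubeVerticesOn_finite S₃ S₄
  have hAB := cubeVerticesOn_inter_nonempty (P := S₁) (Q := S₂) (R := S₃)
  have hBC := cubeVerticesOn_inter_nonempty (P := S₂) (Q := S₃) (R := S₄)
  have hABC := cubeVerticesOn_chain_inter_nonempty (S₁ := S₁) (S₂ := S₂) (S₃ := S₃) (S₄ := S₄)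
  rw [← Set.ncard_pos fB] at hABC
  rw [← Set.ncard_pos (fA.inter_of_left _)] at hAB hABC
  rw [← Set.ncard_pos (fB.inter_of_left _)] at hBC hABC
  rw [← Set.ncard_pos (fA.inter_of_left _)] at hABC
  generalize cubeVerticesOn S₁ S₂ = A at *
  generalize cubeVerticesOn S₂ S₃ = B at *
  generalize cubeVerticesOn S₃ S₄ = C at *
  have e₁ := Set.ncard_union_add_ncard_inter A B fA fB
  have e₂ := Set.ncard_union_add_ncard_inter (A ∪ B) C (fA.union fB) fC
  have f₁ : (A ∩ C).ncard ≤ ((A ∪ B) ∩ C).ncard :=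
    Set.ncard_le_ncard (by gcongr; exact Set.subset_union_left) ((fA.union fB).inter_of_left _)
  have f₂ : (B ∩ C).ncard ≤ ((A ∪ B) ∩ C).ncard :=
    Set.ncard_le_ncard (by gcongr; exact Set.subset_union_right) ((fA.union fB).inter_of_left _)
  omega
end

section
/- (Lower-bound theorem) Let k ≥ 2. Every polygonal chain in ℝ^k that covers the vertex set H(2,k) = {0,1}^k has at least 3·2^{k−2} links; that is, if S_1,…,S_{m+1} ∈ ℝ^k are such that every point of {0,1}^k lies in the union of the segments [S_j, S_{j+1}] for j = 1,…,m, then m ≥ 3·2^{k−2}. -/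
/-- The vertices of the unit hypercube `{0,1}^k`. -/
noncomputable def cubeVertices (k : ℕ) : Finset (Fin k → ℝ) :=
  Fintype.piFinset fun _ => {0, 1}

theorem mem_cubeVertices {k : ℕ} {v : Fin k → ℝ} :
    v ∈ cubeVertices k ↔ ∀ i, v i = 0 ∨ v i = 1 := by
  simp [cubeVertices]

theorem card_cubeVertices (k : ℕ) : (cubeVertices k).card = 2 ^ k := by
  simp [cubeVertices, Fintype.card_piFinset]

open Classical in
/-- The hypercube vertices lying on the segment `[P, Q]`. -/
noncomputable def verticesOn {k : ℕ} (P Q : Fin k → ℝ) : Finset (Fin k → ℝ) :=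
  (cubeVertices k).filter (· ∈ segment ℝ P Q)

theorem mem_verticesOn {k : ℕ} {P Q v : Fin k → ℝ} :
    v ∈ verticesOn P Q ↔ v ∈ cubeVertices k ∧ v ∈ segment ℝ P Q := by
  simp [verticesOn]

theorem verticesOn_symm {k : ℕ} (P Q : Fin k → ℝ) : verticesOn P Q = verticesOn Q P := by
  ext v
  rw [mem_verticesOn, mem_verticesOn, segment_symm]

/-- `Q` lies on the ray from `a` through `b`, not before `b`. -/
def Beyond {k : ℕ} (a b Q : Fin k → ℝ) : Prop :=
  ∃ s : ℝ, 0 ≤ s ∧ ∀ i, Q i = b i + s * (b i - a i)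

theorem beyond_or_beyond {k : ℕ} {P Q a b : Fin k → ℝ} (ha : a ∈ segment ℝ P Q)
    (hb : b ∈ segment ℝ P Q) (hab : a ≠ b) : Beyond a b Q ∨ Beyond b a Q := by
  rw [segment_eq_image'] at ha hb
  obtain ⟨p, ⟨-, hp⟩, rfl⟩ := ha
  obtain ⟨q, ⟨-, hq⟩, rfl⟩ := hb
  have key : ∀ p q : ℝ, q ≤ 1 → p < q →
      Beyond (P + p • (Q - P)) (P + q • (Q - P)) Q := by
    intro p q hq hpq
    have hpos : 0 < q - p := sub_pos.2 hpq
    refine ⟨(1 - q) / (q - p), div_nonneg (sub_nonneg.2 hq) hpos.le, fun i => ?_⟩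
    simp only [Pi.add_apply, Pi.smul_apply, Pi.sub_apply, smul_eq_mul]
    field_simp
    ring
  rcases lt_trichotomy p q with h | rfl | h
  · exact Or.inl (key p q hq h)
  · exact absurd rfl hab
  · exact Or.inr (key q p hp h)

/-- The hypercube vertex last passed before reaching `Q` depends only on `Q`. -/
theorem Beyond.unique {k : ℕ} {a b c d Q : Fin k → ℝ} (ha : a ∈ cubeVertices k)
    (hb : b ∈ cubeVertices k) (hc : c ∈ cubeVertices k) (hd : d ∈ cubeVertices k)
    (hab : Beyond a b Q) (hcd : Beyond c d Q) : b = d := by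
  rw [mem_cubeVertices] at ha hb hc hd
  obtain ⟨s, hs, hQs⟩ := hab
  obtain ⟨t, ht, hQt⟩ := hcd
  ext i
  have h := (hQs i).symm.trans (hQt i)
  rcases ha i with ha | ha <;> rcases hb i with hb | hb <;> rcases hc i with hc | hc <;>
    rcases hd i with hd | hd <;> rw [ha, hb, hc, hd] at h <;> rw [hb, hd] <;> linarith

/-- Two pairs of hypercube vertices on segments ending at a common point share a vertex. -/
theorem not_disjoint_pairs {k : ℕ} {P Q R a b c d : Fin k → ℝ} (ha : a ∈ verticesOn P Q)
    (hb : b ∈ verticesOn P Q) (hc : c ∈ verticesOn R Q) (hd : d ∈ verticesOn R Q)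
    (hab : a ≠ b) (hcd : c ≠ d) : a = c ∨ a = d ∨ b = c ∨ b = d := by
  rw [mem_verticesOn] at ha hb hc hd
  rcases beyond_or_beyond ha.2 hb.2 hab with h | h <;>
    rcases beyond_or_beyond hc.2 hd.2 hcd with h' | h'
  · exact .inr <| .inr <| .inr <| h.unique ha.1 hb.1 hc.1 hd.1 h'
  · exact .inr <| .inr <| .inl <| h.unique ha.1 hb.1 hd.1 hc.1 h'
  · exact .inr <| .inl <| h.unique hb.1 ha.1 hc.1 hd.1 h'
  · exact .inl <| h.unique hb.1 ha.1 hd.1 hc.1 h'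

theorem card_verticesOn_le {k : ℕ} (P Q : Fin k → ℝ) : (verticesOn P Q).card ≤ 2 := by
  by_contra! hcard
  obtain ⟨a, b, c, ha, hb, hc, hab, hac, hbc⟩ := Finset.two_lt_card_iff.1 hcard
  rw [mem_verticesOn] at ha hb hc
  have hab' := beyond_or_beyond ha.2 hb.2 hab
  have hac' := beyond_or_beyond ha.2 hc.2 hac
  have hbc' := beyond_or_beyond hb.2 hc.2 hbc
  have U : ∀ {w x y z}, w ∈ cubeVertices k → x ∈ cubeVertices k → y ∈ cubeVertices k →
      z ∈ cubeVertices k → Beyond w x Q → Beyond y z Q → x = z :=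
    fun hw hx hy hz h h' => h.unique hw hx hy hz h'
  rcases hab' with h | h <;> rcases hac' with h' | h'
  · exact hbc (U ha.1 hb.1 ha.1 hc.1 h h')
  · exact hab (U ha.1 hb.1 hc.1 ha.1 h h').symm
  · exact hac (U hb.1 ha.1 ha.1 hc.1 h h')
  · rcases hbc' with g | g
    · exact hac (U hb.1 ha.1 hb.1 hc.1 h g)
    · exact hab (U hb.1 ha.1 hc.1 hb.1 h g)

open Classical in
theorem card_union_verticesOn_le {k : ℕ} (P Q R : Fin k → ℝ) :
    (verticesOn P Q ∪ verticesOn Q R).card ≤ 3 := by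
  by_contra! hcard
  have h₁ := card_verticesOn_le P Q
  have h₂ := card_verticesOn_le Q R
  have h₃ := Finset.card_union_add_card_inter (verticesOn P Q) (verticesOn Q R)
  obtain ⟨a, ha, b, hb, hab⟩ := Finset.one_lt_card.1 (by omega : 1 < (verticesOn P Q).card)
  obtain ⟨c, hc, d, hd, hcd⟩ := Finset.one_lt_card.1 (by omega : 1 < (verticesOn Q R).card)
  have hdisj : Disjoint (verticesOn P Q) (verticesOn Q R) := by
    rw [Finset.disjoint_iff_inter_eq_empty, ← Finset.card_eq_zero]
    omega
  have hne := Finset.disjoint_iff_ne.1 hdisj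
  rcases not_disjoint_pairs ha hb (verticesOn_symm Q R ▸ hc) (verticesOn_symm Q R ▸ hd) hab hcd
    with h | h | h | h
  · exact hne a ha c hc h
  · exact hne a ha d hd h
  · exact hne b hb c hc h
  · exact hne b hb d hd h

/-- A segment joining the rays `a b` and `e d` beyond `b` and `d` meets no fifth vertex. -/
theorem eq_of_mem_segment_of_beyond {k : ℕ} {a b c d e Q R : Fin k → ℝ}
    (ha : a ∈ cubeVertices k) (hb : b ∈ cubeVertices k) (hc : c ∈ cubeVertices k)
    (hd : d ∈ cubeVertices k) (he : e ∈ cubeVertices k) (hQ : Beyond a b Q) (hR : Beyond e d R)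
    (hcQR : c ∈ segment ℝ Q R) : c = b ∨ c = d ∨ a = d ∨ e = b ∨ a = e := by
  rw [mem_cubeVertices] at ha hb hc hd he
  obtain ⟨s, hs, hQs⟩ := hQ
  obtain ⟨t, ht, hRt⟩ := hR
  obtain ⟨w, u, hw, hu, hwu, hcomb⟩ := hcQR
  obtain rfl : w = 1 - u := by linarith
  obtain ⟨A, hA⟩ : ∃ A, A = (1 - u) * s := ⟨_, rfl⟩
  obtain ⟨B, hB⟩ : ∃ B, B = u * t := ⟨_, rfl⟩
  have hA0 : 0 ≤ A := hA ▸ mul_nonneg hw hs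
  have hB0 : 0 ≤ B := hB ▸ mul_nonneg hu ht
  have hlin : ∀ i, c i = (1 - u) * b i + A * (b i - a i) + u * d i + B * (d i - e i) := by
    intro i
    have := congrFun hcomb i
    simp only [Pi.add_apply, Pi.smul_apply, smul_eq_mul, hQs, hRt] at this
    rw [← this, hA, hB]
    ring
  by_contra! hne
  obtain ⟨hcb, hcd, had, heb, hae⟩ := hne
  obtain ⟨i, hi⟩ := Function.ne_iff.1 hcb
  obtain ⟨j, hj⟩ := Function.ne_iff.1 hcd
  obtain ⟨l, hl⟩ := Function.ne_iff.1 had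
  obtain ⟨n, hn⟩ := Function.ne_iff.1 heb
  obtain ⟨p, hp⟩ := Function.ne_iff.1 hae
  have hBpos : 1 - u ≤ B := by
    have h := hlin i
    rcases ha i with h₁ | h₁ <;> rcases hb i with h₂ | h₂ <;> rcases hc i with h₃ | h₃ <;>
      rcases hd i with h₄ | h₄ <;> rcases he i with h₅ | h₅ <;>
      rw [h₁, h₂, h₃, h₄, h₅] at h <;> rw [h₂, h₃] at hi <;>
      first | exact absurd rfl hi | linarith
  have hApos : u ≤ A := by
    have h := hlin j
    rcases ha j with h₁ | h₁ <;> rcases hb j with h₂ | h₂ <;> rcases hc j with h₃ | h₃ <;>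
      rcases hd j with h₄ | h₄ <;> rcases he j with h₅ | h₅ <;>
      rw [h₁, h₂, h₃, h₄, h₅] at h <;> rw [h₃, h₄] at hj <;>
      first | exact absurd rfl hj | linarith
  have hu0 : 0 < u := by
    refine hu.lt_of_ne fun h => ?_
    rw [← h] at hB hBpos
    linarith
  have hu1 : 0 < 1 - u := by
    refine hw.lt_of_ne fun h => ?_
    rw [← h] at hA
    linarith
  have hBeq : B = 1 - u := by
    have h := hlin l
    rcases ha l with h₁ | h₁ <;> rcases hb l with h₂ | h₂ <;> rcases hc l with h₃ | h₃ <;>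
      rcases hd l with h₄ | h₄ <;> rcases he l with h₅ | h₅ <;>
      rw [h₁, h₂, h₃, h₄, h₅] at h <;> rw [h₁, h₄] at hl <;>
      first | exact absurd rfl hl | linarith
  have hAeq : A = u := by
    have h := hlin n
    rcases ha n with h₁ | h₁ <;> rcases hb n with h₂ | h₂ <;> rcases hc n with h₃ | h₃ <;>
      rcases hd n with h₄ | h₄ <;> rcases he n with h₅ | h₅ <;>
      rw [h₁, h₂, h₃, h₄, h₅] at h <;> rw [h₂, h₅] at hn <;>
      first | exact absurd rfl hn | linarith
  have h := hlin p
  rcases ha p with h₁ | h₁ <;> rcases hb p with h₂ | h₂ <;> rcases hc p with h₃ | h₃ <;>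
    rcases hd p with h₄ | h₄ <;> rcases he p with h₅ | h₅ <;>
    rw [h₁, h₂, h₃, h₄, h₅] at h <;> rw [h₁, h₅] at hp <;>
    first | exact absurd rfl hp | linarith

open Classical in
theorem card_union_union_verticesOn_le {k : ℕ} (P Q R T : Fin k → ℝ) :
    (verticesOn P Q ∪ verticesOn Q R ∪ verticesOn R T).card ≤ 4 := by
  by_contra! hcard
  have hXY := card_union_verticesOn_le P Q R
  have hYZ := card_union_verticesOn_le Q R T
  have hX2 := card_verticesOn_le P Q
  have hZ2 := card_verticesOn_le R T
  rw [verticesOn_symm R T] at hcard hYZ hZ2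
  set X := verticesOn P Q
  set Y := verticesOn Q R
  set Z := verticesOn T R
  have hZ' : 1 < (Z \ (X ∪ Y)).card := by
    have := Finset.card_union_add_card_inter (X ∪ Y) Z
    have := Finset.card_sdiff_add_card_inter Z (X ∪ Y)
    rw [Finset.inter_comm] at this
    omega
  have hX' : 1 < (X \ (Y ∪ Z)).card := by
    have := Finset.card_union_add_card_inter X (Y ∪ Z)
    have := Finset.card_sdiff_add_card_inter X (Y ∪ Z)
    rw [Finset.union_assoc] at hcard
    omega
  have hY' : 0 < (Y \ (X ∪ Z)).card := by
    have := Finset.card_union_add_card_inter Y (X ∪ Z)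
    have := Finset.card_sdiff_add_card_inter Y (X ∪ Z)
    have := Finset.card_union_le X Z
    rw [Finset.union_comm X Y, Finset.union_assoc] at hcard
    omega
  obtain ⟨a, ha, b, hb, hab⟩ := Finset.one_lt_card.1 hX'
  obtain ⟨d, hd, e, he, hde⟩ := Finset.one_lt_card.1 hZ'
  obtain ⟨c, hc⟩ := Finset.card_pos.1 hY'
  simp only [Finset.mem_sdiff, Finset.mem_union, not_or] at ha hb hc hd he
  have key : ∀ a b d e, a ∈ X → b ∈ X → d ∈ Z → e ∈ Z → d ∉ X → e ∉ X →
      Beyond a b Q → Beyond e d R → False := by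
    intro a b d e ha hb hd he hd' he' hbQ hdR
    rcases eq_of_mem_segment_of_beyond (mem_verticesOn.1 ha).1 (mem_verticesOn.1 hb).1
      (mem_verticesOn.1 hc.1).1 (mem_verticesOn.1 hd).1 (mem_verticesOn.1 he).1 hbQ hdR
      (mem_verticesOn.1 hc.1).2 with h | h | h | h | h
    · exact hc.2.1 (h ▸ hb)
    · exact hc.2.2 (h ▸ hd)
    · exact hd' (h ▸ ha)
    · exact he' (h ▸ hb)
    · exact he' (h ▸ ha)
  rcases beyond_or_beyond (mem_verticesOn.1 ha.1).2 (mem_verticesOn.1 hb.1).2 hab with h | h <;>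
    rcases beyond_or_beyond (mem_verticesOn.1 hd.1).2 (mem_verticesOn.1 he.1).2 hde with h' | h'
  · exact key a b e d ha.1 hb.1 he.1 hd.1 he.2.1 hd.2.1 h h'
  · exact key a b d e ha.1 hb.1 hd.1 he.1 hd.2.1 he.2.1 h h'
  · exact key b a e d hb.1 ha.1 he.1 hd.1 he.2.1 hd.2.1 h h'
  · exact key b a d e hb.1 ha.1 hd.1 he.1 hd.2.1 he.2.1 h h'

open Classical in
/-- The hypercube vertices lying on the first `m` links of the chain `P 0, P 1, …`. -/
noncomputable def verticesOnChain {k : ℕ} (P : ℕ → Fin k → ℝ) (m : ℕ) : Finset (Fin k → ℝ) :=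
  (Finset.range m).biUnion fun j => verticesOn (P j) (P (j + 1))

open Classical in
theorem verticesOnChain_succ {k : ℕ} (P : ℕ → Fin k → ℝ) (m : ℕ) :
    verticesOnChain P (m + 1) = verticesOnChain P m ∪ verticesOn (P m) (P (m + 1)) := by
  rw [verticesOnChain, Finset.range_add_one, Finset.biUnion_insert, Finset.union_comm]
  rfl

open Classical in
theorem card_verticesOnChain_three_mul_le {k : ℕ} (P : ℕ → Fin k → ℝ) (q : ℕ) :
    (verticesOnChain P (3 * q)).card ≤ 4 * q := by
  induction q with
  | zero => simp [verticesOnChain]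
  | succ q ih =>
    rw [mul_add_one, verticesOnChain_succ, verticesOnChain_succ, verticesOnChain_succ,
      Finset.union_assoc, Finset.union_assoc, ← Finset.union_assoc (verticesOn _ _)]
    calc _ ≤ _ := Finset.card_union_le _ _
      _ ≤ _ := Nat.add_le_add ih (card_union_union_verticesOn_le _ _ _ _)

open Classical in
theorem card_verticesOnChain_lt {k : ℕ} (P : ℕ → Fin k → ℝ) (m : ℕ) :
    3 * (verticesOnChain P m).card < 4 * m + 3 := by
  have h := card_verticesOnChain_three_mul_le P (m / 3)
  obtain h' | h' | h' : m = 3 * (m / 3) ∨ m = 3 * (m / 3) + 1 ∨ m = 3 * (m / 3) + 2 := by omega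
  all_goals generalize m / 3 = q at h h'; subst h'
  · omega
  · rw [verticesOnChain_succ]
    have h₁ := Finset.card_union_le (verticesOnChain P (3 * q))
      (verticesOn (P (3 * q)) (P (3 * q + 1)))
    have h₂ := card_verticesOn_le (P (3 * q)) (P (3 * q + 1))
    omega
  · rw [verticesOnChain_succ, verticesOnChain_succ, Finset.union_assoc]
    have h₁ := Finset.card_union_le (verticesOnChain P (3 * q))
      (verticesOn (P (3 * q)) (P (3 * q + 1)) ∪ verticesOn (P (3 * q + 1)) (P (3 * q + 1 + 1)))
    have h₂ := card_union_verticesOn_le (P (3 * q)) (P (3 * q + 1)) (P (3 * q + 1 + 1))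
    omega

/-- (Lower-bound theorem) For `k ≥ 2`, every polygonal chain in `ℝ^k`
(with vertices `S 0, …, S m`) covering all vertices of the unit hypercube
`{0,1}^k` has at least `3 · 2^(k-2)` links. -/
theorem covering_chain_lower_bound (k : ℕ) (hk : 2 ≤ k)
    (m : ℕ) (S : Fin (m + 1) → (Fin k → ℝ))
    (hcover : ∀ v : Fin k → ℝ, (∀ i, v i = 0 ∨ v i = 1) →
      ∃ j : Fin m, v ∈ segment ℝ (S j.castSucc) (S j.succ)) :
    3 * 2 ^ (k - 2) ≤ m := by
  let P : ℕ → Fin k → ℝ := fun n => S (Fin.ofNat (m + 1) n)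
  have hsub : cubeVertices k ⊆ verticesOnChain P m := by
    intro v hv
    obtain ⟨j, hj⟩ := hcover v (mem_cubeVertices.1 hv)
    refine Finset.mem_biUnion.2 ⟨j, Finset.mem_range.2 j.2, mem_verticesOn.2 ⟨hv, ?_⟩⟩
    have h₁ : Fin.ofNat (m + 1) j = j.castSucc := Fin.ext (Nat.mod_eq_of_lt (by simp))
    have h₂ : Fin.ofNat (m + 1) (j + 1) = j.succ := Fin.ext (Nat.mod_eq_of_lt (by simp))
    simpa only [P, h₁, h₂] using hj
  have hcard := Finset.card_le_card hsub
  have hlt := card_verticesOnChain_lt P m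
  obtain ⟨n, rfl⟩ := Nat.exists_eq_add_of_le' hk
  rw [card_cubeVertices, pow_add] at hcard
  rw [Nat.add_sub_cancel]
  omega
end

section
/- (Upper-bound theorem) Let k ≥ 2. There exists a closed polygonal chain in ℝ^k with exactly 3·2^{k−2} links that covers the vertex set H(2,k) = {0,1}^k; that is, there exist points S_1,…,S_{m+1} ∈ ℝ^k with m = 3·2^{k−2} and S_{m+1} = S_1 such that every point of {0,1}^k lies in the union of the segments [S_j, S_{j+1}] for j = 1,…,m. -/
/-- Sign vectors on `n + 1` coordinates with first entry `1`, indexed by the binary digits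
of a natural number. -/
noncomputable def signVector (n b : ℕ) : Fin (n + 1) → ℝ :=
  Fin.cons 1 fun i : Fin n => if b.testBit i then 1 else -1

/-- Every sign vector is, up to a global sign, one of the first `2 ^ n` vectors `signVector n b`. -/
lemma exists_signVector_eq_or_eq_neg (n : ℕ) (τ : Fin (n + 1) → ℝ)
    (hτ : ∀ i, τ i = 1 ∨ τ i = -1) :
    ∃ b < 2 ^ n, τ = signVector n b ∨ τ = -signVector n b := by
  refine ⟨Nat.ofBits fun i : Fin n => decide (τ i.succ = τ 0), Nat.ofBits_lt_two_pow _, ?_⟩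
  rcases hτ 0 with h0 | h0
  · left
    funext i
    refine Fin.cases ?_ (fun i => ?_) i
    · simpa [signVector] using h0
    · rcases hτ i.succ with h | h <;> simp [signVector, h0, h]
  · right
    funext i
    refine Fin.cases ?_ (fun i => ?_) i
    · simpa [signVector] using h0
    · rcases hτ i.succ with h | h <;> norm_num [signVector, h0, h]

/-- The vertices of a chain of triangles with common apex `(2, 1/2, …, 1/2)`. The base of each
triangle lies in the hyperplane of vanishing first coordinate, along a long diagonal of the
facet of the hypercube in that hyperplane. -/
noncomputable def triangleChain (n j : ℕ) : Fin (n + 2) → ℝ :=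
  if j % 3 = 0 then Fin.cons 2 fun _ => 1 / 2
  else if j % 3 = 1 then Fin.cons 0 fun i => 1 / 2 + signVector n (j / 3) i
  else Fin.cons 0 fun i => 1 / 2 - signVector n (j / 3) i

lemma triangleChain_three_mul (n b : ℕ) :
    triangleChain n (3 * b) = Fin.cons 2 fun _ => 1 / 2 := by
  simp [triangleChain]

lemma triangleChain_three_mul_add_one (n b : ℕ) :
    triangleChain n (3 * b + 1) = Fin.cons 0 fun i => 1 / 2 + signVector n b i := by
  have h1 : (3 * b + 1) % 3 = 1 := by omega
  have h2 : (3 * b + 1) / 3 = b := by omega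
  simp [triangleChain, h1, h2]

lemma triangleChain_three_mul_add_two (n b : ℕ) :
    triangleChain n (3 * b + 2) = Fin.cons 0 fun i => 1 / 2 - signVector n b i := by
  have h1 : (3 * b + 2) % 3 = 2 := by omega
  have h2 : (3 * b + 2) / 3 = b := by omega
  simp [triangleChain, h1, h2]

lemma exists_mem_segment_triangleChain (n : ℕ) (v : Fin (n + 2) → ℝ)
    (hv : ∀ i, v i = 0 ∨ v i = 1) :
    ∃ j < 3 * 2 ^ n, v ∈ segment ℝ (triangleChain n j) (triangleChain n (j + 1)) := by
  obtain ⟨b, hb, hτ⟩ := exists_signVector_eq_or_eq_neg n (fun i => 2 * v i.succ - 1) (by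
    intro i
    rcases hv i.succ with h | h <;> norm_num [h])
  rcases hv 0 with h0 | h0
  · refine ⟨3 * b + 1, by omega, ?_⟩
    rw [triangleChain_three_mul_add_one, triangleChain_three_mul_add_two]
    rcases hτ with h | h
    · refine ⟨3 / 4, 1 / 4, by norm_num, by norm_num, by norm_num, ?_⟩
      funext i
      refine Fin.cases (by simp [h0]) (fun i => ?_) i
      have := congrFun h i
      simp only [Pi.add_apply, Pi.smul_apply, Fin.cons_succ, smul_eq_mul]
      linarith
    · refine ⟨1 / 4, 3 / 4, by norm_num, by norm_num, by norm_num, ?_⟩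
      funext i
      refine Fin.cases (by simp [h0]) (fun i => ?_) i
      have := congrFun h i
      simp only [Pi.add_apply, Pi.smul_apply, Pi.neg_apply, Fin.cons_succ, smul_eq_mul] at this ⊢
      linarith
  · rcases hτ with h | h
    · refine ⟨3 * b, by omega, ?_⟩
      rw [triangleChain_three_mul, triangleChain_three_mul_add_one]
      refine ⟨1 / 2, 1 / 2, by norm_num, by norm_num, by norm_num, ?_⟩
      funext i
      refine Fin.cases (by simp [h0]) (fun i => ?_) i
      have := congrFun h i
      simp only [Pi.add_apply, Pi.smul_apply, Fin.cons_succ, smul_eq_mul]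
      linarith
    · refine ⟨3 * b + 2, by omega, ?_⟩
      rw [triangleChain_three_mul_add_two, show 3 * b + 2 + 1 = 3 * (b + 1) by ring,
        triangleChain_three_mul]
      refine ⟨1 / 2, 1 / 2, by norm_num, by norm_num, by norm_num, ?_⟩
      funext i
      refine Fin.cases (by simp [h0]) (fun i => ?_) i
      have := congrFun h i
      simp only [Pi.add_apply, Pi.smul_apply, Pi.neg_apply, Fin.cons_succ, smul_eq_mul] at this ⊢
      linarith

/-- (Upper-bound theorem) For `k ≥ 2`, there exists a closed polygonal chain in
`ℝ^k` with exactly `3 · 2^(k-2)` links covering all vertices of the unit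
hypercube `{0,1}^k`. -/
theorem covering_cycle_upper_bound (k : ℕ) (hk : 2 ≤ k) :
    ∃ S : Fin (3 * 2 ^ (k - 2) + 1) → (Fin k → ℝ),
      S (Fin.last (3 * 2 ^ (k - 2))) = S 0 ∧
      ∀ v : Fin k → ℝ, (∀ i, v i = 0 ∨ v i = 1) →
        ∃ j : Fin (3 * 2 ^ (k - 2)), v ∈ segment ℝ (S j.castSucc) (S j.succ) := by
  obtain ⟨n, rfl⟩ := Nat.exists_eq_add_of_le' hk
  refine ⟨fun j => triangleChain n j, ?_, fun v hv => ?_⟩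
  · simp [triangleChain]
  · obtain ⟨j, hj, hmem⟩ := exists_mem_segment_triangleChain n v hv
    exact ⟨⟨j, hj⟩, hmem⟩
end

section
/- (Corollary: perfect covering cycle) Let k ≥ 2 and set m = 3·2^{k−2}. There exist points S_1,…,S_{m+1} ∈ ℝ^k such that S_{m+1} = S_1, the points S_1,…,S_m are pairwise distinct, every point of {0,1}^k lies in the union of the segments [S_j, S_{j+1}] for j = 1,…,m, and moreover every point of {0,1}^k belongs to exactly one of these m segments. -/
namespace CoveringCycle

/-- The sign vector encoded by the binary digits of `i`; coordinate `1` is always positive. -/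
noncomputable def signs (n i : ℕ) (l : Fin (n + 2)) : ℝ :=
  if (l : ℕ) ≤ 1 then 1 else if i.testBit (l - 2) then 1 else -1

/-- The point at height `h` (coordinate `0`) and at signed offset `c` along the `i`-th diagonal. -/
noncomputable def diagPoint (n i : ℕ) (c h : ℝ) (l : Fin (n + 2)) : ℝ :=
  if l = 0 then h else 1 / 2 + c * signs n i l

/-- The vertices of the cycle: an apex above the centre of the facet, followed by two points on the
`i`-th diagonal of that facet. -/
noncomputable def vertex (n j : ℕ) : Fin (n + 2) → ℝ :=
  if j % 3 = 0 then diagPoint n (j / 3) 0 (2 + (j / 3 % 2 ^ n : ℕ))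
  else if j % 3 = 1 then
    diagPoint n (j / 3) (-(1 + 1 / (1 + (j / 3 % 2 ^ n : ℕ))) / 2) 0
  else diagPoint n (j / 3) ((1 + 1 / (1 + ((j / 3 + 1) % 2 ^ n : ℕ))) / 2) 0

lemma signs_one (n i : ℕ) : signs n i 1 = 1 := by simp [signs]

lemma diagPoint_zero (n i : ℕ) (c h : ℝ) : diagPoint n i c h 0 = h := by simp [diagPoint]

lemma diagPoint_one (n i : ℕ) (c h : ℝ) : diagPoint n i c h 1 = 1 / 2 + c := by
  simp [diagPoint, signs_one]

lemma diagPoint_offset_zero (n i i' : ℕ) (h : ℝ) : diagPoint n i 0 h = diagPoint n i' 0 h := by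
  ext l; simp [diagPoint]

lemma eq_of_signs_eq {n i i' : ℕ} (hi : i < 2 ^ n) (hi' : i' < 2 ^ n)
    (h : ∀ l, l ≠ 0 → signs n i l = signs n i' l) : i = i' := by
  apply Nat.eq_of_testBit_eq
  intro b
  by_cases hb : b < n
  · have := h ⟨b + 2, by omega⟩ (by simp [Fin.ext_iff])
    simp only [signs] at this
    cases h1 : i.testBit b <;> cases h2 : i'.testBit b <;> simp [h1, h2] at this ⊢ <;>
      norm_num at this
  · have hle : 2 ^ n ≤ 2 ^ b := Nat.pow_le_pow_right (by norm_num) (by omega)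
    rw [Nat.testBit_lt_two_pow (hi.trans_le hle), Nat.testBit_lt_two_pow (hi'.trans_le hle)]

lemma diagPoint_inj {n i i' : ℕ} {c c' h h' : ℝ} (hi : i < 2 ^ n) (hi' : i' < 2 ^ n) (hc : c ≠ 0)
    (e : diagPoint n i c h = diagPoint n i' c' h') : i = i' := by
  have h1 := congrFun e 1
  rw [diagPoint_one, diagPoint_one] at h1
  obtain rfl : c = c' := by linarith
  refine eq_of_signs_eq hi hi' fun l hl => ?_
  have := congrFun e l
  simp only [diagPoint, hl, if_false] at this
  exact mul_left_cancel₀ hc (by linarith)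

/-- `v` lies in the plane spanned by the `i`-th diagonal and the vertical axis of the facet. -/
def Aligned (n i : ℕ) (v : Fin (n + 2) → ℝ) : Prop :=
  ∀ l, l ≠ 0 → v l = 1 / 2 + (v 1 - 1 / 2) * signs n i l

lemma mem_segment_diagPoint {n i : ℕ} {c h c' h' : ℝ} {v : Fin (n + 2) → ℝ} :
    v ∈ segment ℝ (diagPoint n i c h) (diagPoint n i c' h') ↔
      Aligned n i v ∧ ∃ a b : ℝ, 0 ≤ a ∧ 0 ≤ b ∧ a + b = 1 ∧
        a * h + b * h' = v 0 ∧ 1 / 2 + (a * c + b * c') = v 1 := by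
  constructor
  · rintro ⟨a, b, ha, hb, hab, rfl⟩
    have key : ∀ l, l ≠ 0 → (a • diagPoint n i c h + b • diagPoint n i c' h') l =
        1 / 2 + (a * c + b * c') * signs n i l := by
      intro l hl
      simp only [Pi.add_apply, Pi.smul_apply, smul_eq_mul, diagPoint, hl, if_false]
      linear_combination (1 / 2) * hab
    refine ⟨fun l hl => ?_, a, b, ha, hb, hab, ?_, ?_⟩
    · rw [key l hl, key 1 (by simp), signs_one]; ring
    · simp [diagPoint_zero]
    · rw [key 1 (by simp), signs_one]; ring
  · rintro ⟨hv, a, b, ha, hb, hab, h0, h1⟩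
    refine ⟨a, b, ha, hb, hab, ?_⟩
    ext l
    simp only [Pi.add_apply, Pi.smul_apply, smul_eq_mul]
    by_cases hl : l = 0
    · subst hl; simpa [diagPoint_zero] using h0
    · rw [hv l hl, ← h1]
      simp only [diagPoint, hl, if_false]
      linear_combination (1 / 2) * hab

lemma existsUnique_aligned {n : ℕ} {v : Fin (n + 2) → ℝ} (hv : ∀ l, v l = 0 ∨ v l = 1) :
    ∃ i < 2 ^ n, Aligned n i v ∧ ∀ i' < 2 ^ n, Aligned n i' v → i' = i := by
  classical
  refine ⟨Nat.ofBits fun b : Fin n => decide (v ⟨b + 2, by omega⟩ = v 1),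
    Nat.ofBits_lt_two_pow _, ?_⟩
  have hA : Aligned n (Nat.ofBits fun b : Fin n => decide (v ⟨b + 2, by omega⟩ = v 1)) v := by
    intro l hl
    obtain ⟨l, hlt⟩ := l
    match l, hlt with
    | 0, _ => simp at hl
    | 1, _ =>
      change v 1 = 1 / 2 + (v 1 - 1 / 2) * signs n _ 1
      rw [signs_one]; ring
    | b + 2, hlt =>
      have hb : b < n := by omega
      simp only [signs, Nat.add_sub_cancel, Nat.testBit_ofBits_lt _ _ hb,
        if_neg (show ¬b + 2 ≤ 1 by omega)]
      rcases hv ⟨b + 2, hlt⟩ with h | h <;> rcases hv 1 with h1 | h1 <;> norm_num [h, h1]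
  refine ⟨hA, fun i' hi' h' => ?_⟩
  refine eq_of_signs_eq hi' (Nat.ofBits_lt_two_pow _) fun l hl => ?_
  have hne : v 1 - 1 / 2 ≠ 0 := by rcases hv 1 with h | h <;> norm_num [h]
  refine mul_left_cancel₀ hne ?_
  linarith [h' l hl, hA l hl]

lemma mem_descending_link {n i : ℕ} {q : ℝ} (hq : 0 < q) {v : Fin (n + 2) → ℝ}
    (h0 : v 0 = 0 ∨ v 0 = 1) (h1 : v 1 = 0 ∨ v 1 = 1) :
    v ∈ segment ℝ (diagPoint n i 0 (1 + q)) (diagPoint n i (-(1 + 1 / q) / 2) 0) ↔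
      Aligned n i v ∧ v 0 = 1 ∧ v 1 = 0 := by
  rw [mem_segment_diagPoint]
  refine and_congr_right fun _ => ⟨?_, ?_⟩
  · rintro ⟨a, b, ha, hb, hab, e0, e1⟩
    obtain rfl : b = 1 - a := by linarith
    field_simp at e1
    rcases h0 with h0 | h0 <;> rcases h1 with h1 | h1 <;> rw [h0] at e0 <;> rw [h1] at e1 <;>
      simp only [h0, h1] <;> norm_num <;> nlinarith
  · rintro ⟨h0, h1⟩
    refine ⟨1 / (1 + q), q / (1 + q), by positivity, by positivity, by field_simp, ?_, ?_⟩
    · rw [h0]; field_simp; ring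
    · rw [h1]; field_simp; ring

lemma mem_diagonal_link {n i : ℕ} {q q' : ℝ} (hq : 0 < q) (hq' : 0 < q') {v : Fin (n + 2) → ℝ}
    (h1 : v 1 = 0 ∨ v 1 = 1) :
    v ∈ segment ℝ (diagPoint n i (-(1 + 1 / q) / 2) 0) (diagPoint n i ((1 + 1 / q') / 2) 0) ↔
      Aligned n i v ∧ v 0 = 0 := by
  rw [mem_segment_diagPoint]
  refine and_congr_right fun _ => ⟨?_, ?_⟩
  · rintro ⟨a, b, ha, hb, hab, e0, e1⟩
    linarith
  · intro h0
    have hr : 0 < 1 / q := by positivity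
    have hr' : 0 < 1 / q' := by positivity
    generalize 1 / q = r at *
    generalize 1 / q' = r' at *
    rcases h1 with h1 | h1
    · refine ⟨(2 + r') / (2 + r + r'), r / (2 + r + r'), by positivity, by positivity,
        by field_simp; ring, by rw [h0]; ring, ?_⟩
      rw [h1]; field_simp; ring
    · refine ⟨r' / (2 + r + r'), (2 + r) / (2 + r + r'), by positivity, by positivity,
        by field_simp; ring, by rw [h0]; ring, ?_⟩
      rw [h1]; field_simp; ring

lemma mem_ascending_link {n i : ℕ} {q : ℝ} (hq : 0 < q) {v : Fin (n + 2) → ℝ}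
    (h0 : v 0 = 0 ∨ v 0 = 1) (h1 : v 1 = 0 ∨ v 1 = 1) :
    v ∈ segment ℝ (diagPoint n i ((1 + 1 / q) / 2) 0) (diagPoint n i 0 (1 + q)) ↔
      Aligned n i v ∧ v 0 = 1 ∧ v 1 = 1 := by
  rw [mem_segment_diagPoint]
  refine and_congr_right fun _ => ⟨?_, ?_⟩
  · rintro ⟨a, b, ha, hb, hab, e0, e1⟩
    obtain rfl : a = 1 - b := by linarith
    field_simp at e1
    rcases h0 with h0 | h0 <;> rcases h1 with h1 | h1 <;> rw [h0] at e0 <;> rw [h1] at e1 <;>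
      simp only [h0, h1] <;> norm_num <;> nlinarith
  · rintro ⟨h0, h1⟩
    refine ⟨q / (1 + q), 1 / (1 + q), by positivity, by positivity, by field_simp; ring, ?_, ?_⟩
    · rw [h0]; field_simp; ring
    · rw [h1]; field_simp; ring

/-- The position, within a triple of consecutive links, of the link that covers `v`. -/
noncomputable def linkKind {n : ℕ} (v : Fin (n + 2) → ℝ) : ℕ :=
  if v 0 = 0 then 1 else if v 1 = 0 then 0 else 2

lemma linkKind_lt {n : ℕ} (v : Fin (n + 2) → ℝ) : linkKind v < 3 := by
  unfold linkKind; split_ifs <;> norm_num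

lemma mem_link_iff {n j : ℕ} {v : Fin (n + 2) → ℝ} (h0 : v 0 = 0 ∨ v 0 = 1)
    (h1 : v 1 = 0 ∨ v 1 = 1) :
    v ∈ segment ℝ (vertex n j) (vertex n (j + 1)) ↔
      Aligned n (j / 3) v ∧ j % 3 = linkKind v := by
  obtain h | h | h : j % 3 = 0 ∨ j % 3 = 1 ∨ j % 3 = 2 := by omega
  · have e1 : (j + 1) % 3 = 1 := by omega
    have e2 : (j + 1) / 3 = j / 3 := by omega
    have := mem_descending_link (n := n) (i := j / 3)
      (q := 1 + (j / 3 % 2 ^ n : ℕ)) (by positivity) h0 h1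
    rw [← add_assoc, one_add_one_eq_two] at this
    simp only [vertex, h, e1, e2, if_true, one_ne_zero, if_false]
    rw [this]
    rcases h0 with h0 | h0 <;> rcases h1 with h1 | h1 <;> simp [linkKind, h0, h1]
  · have e1 : (j + 1) % 3 = 2 := by omega
    have e2 : (j + 1) / 3 = j / 3 := by omega
    have := mem_diagonal_link (n := n) (i := j / 3)
      (q := 1 + (j / 3 % 2 ^ n : ℕ)) (q' := 1 + ((j / 3 + 1) % 2 ^ n : ℕ))
      (by positivity) (by positivity) h1
    simp only [vertex, h, e1, e2, if_true, one_ne_zero, if_false, OfNat.ofNat_ne_zero,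
      OfNat.ofNat_ne_one]
    rw [this]
    rcases h0 with h0 | h0 <;> rcases h1 with h1 | h1 <;> simp [linkKind, h0, h1]
  · have e1 : (j + 1) % 3 = 0 := by omega
    have e2 : (j + 1) / 3 = j / 3 + 1 := by omega
    have := mem_ascending_link (n := n) (i := j / 3)
      (q := 1 + ((j / 3 + 1) % 2 ^ n : ℕ)) (by positivity) h0 h1
    rw [← add_assoc, one_add_one_eq_two] at this
    simp only [vertex, h, e1, e2, if_true, if_false, OfNat.ofNat_ne_zero, OfNat.ofNat_ne_one]
    rw [diagPoint_offset_zero n (j / 3 + 1) (j / 3), this]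
    rcases h0 with h0 | h0 <;> rcases h1 with h1 | h1 <;> simp [linkKind, h0, h1]

lemma vertex_inj {n j j' : ℕ} (hj : j < 3 * 2 ^ n) (hj' : j' < 3 * 2 ^ n)
    (e : vertex n j = vertex n j') : j = j' := by
  have hi : j / 3 < 2 ^ n := by omega
  have hi' : j' / 3 < 2 ^ n := by omega
  have p : ∀ a : ℕ, 0 < 1 / (1 + (a : ℝ)) := fun a => by positivity
  have p1 := p (j / 3 % 2 ^ n)
  have p2 := p (j' / 3 % 2 ^ n)
  have p3 := p ((j / 3 + 1) % 2 ^ n)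
  have p4 := p ((j' / 3 + 1) % 2 ^ n)
  have n1 : (0 : ℝ) ≤ (j / 3 % 2 ^ n : ℕ) := Nat.cast_nonneg _
  have n2 : (0 : ℝ) ≤ (j' / 3 % 2 ^ n : ℕ) := Nat.cast_nonneg _
  have e0 := congrFun e 0
  have e1 := congrFun e 1
  unfold vertex at e e0 e1
  split_ifs at e e0 e1 <;> simp only [diagPoint_zero, diagPoint_one] at e0 e1
  · rw [Nat.mod_eq_of_lt hi, Nat.mod_eq_of_lt hi'] at e0
    have : j / 3 = j' / 3 := by exact_mod_cast add_left_cancel e0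
    omega
  any_goals (exfalso; linarith)
  all_goals
    have := diagPoint_inj hi hi' (by intro hc; linarith) e
    omega

end CoveringCycle

open CoveringCycle in
/-- (Corollary: perfect covering cycle) For `k ≥ 2` and `m = 3 · 2^(k-2)`,
there is a closed polygonal chain `S 0, …, S m` in `ℝ^k` with `S m = S 0`,
whose vertices `S 0, …, S (m-1)` are pairwise distinct, and such that every
vertex of the unit hypercube `{0,1}^k` lies on exactly one of the `m` links. -/
theorem perfect_covering_cycle_exists (k : ℕ) (hk : 2 ≤ k) :
    ∃ S : Fin (3 * 2 ^ (k - 2) + 1) → (Fin k → ℝ),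
      S (Fin.last (3 * 2 ^ (k - 2))) = S 0 ∧
      Function.Injective (fun j : Fin (3 * 2 ^ (k - 2)) => S j.castSucc) ∧
      ∀ v : Fin k → ℝ, (∀ i, v i = 0 ∨ v i = 1) →
        ∃! j : Fin (3 * 2 ^ (k - 2)), v ∈ segment ℝ (S j.castSucc) (S j.succ) := by
  obtain ⟨n, rfl⟩ : ∃ n, k = n + 2 := ⟨k - 2, by omega⟩
  rw [Nat.add_sub_cancel]
  refine ⟨fun j => vertex n j, ?_, fun j j' e => Fin.ext (vertex_inj j.2 j'.2 e), ?_⟩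
  · simp only [Fin.val_last, Fin.val_zero, vertex, Nat.mul_mod_right, Nat.zero_mod, if_true,
      Nat.mul_div_cancel_left _ (by norm_num : 0 < 3), Nat.mod_self, Nat.zero_div]
    exact diagPoint_offset_zero _ _ _ _
  · intro v hv
    obtain ⟨i, hi, hA, huniq⟩ := existsUnique_aligned hv
    have hr := linkKind_lt v
    refine ⟨⟨3 * i + linkKind v, by omega⟩, ?_, ?_⟩
    · refine (mem_link_iff (hv 0) (hv 1)).2 ⟨?_, ?_⟩
      · change Aligned n ((3 * i + linkKind v) / 3) v
        rwa [show (3 * i + linkKind v) / 3 = i by omega]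
      · change (3 * i + linkKind v) % 3 = _
        omega
    · intro j hj
      obtain ⟨h1, h2⟩ := (mem_link_iff (hv 0) (hv 1)).1 hj
      have hlt := j.2
      rw [Fin.val_castSucc] at h1 h2
      have := huniq _ (by omega) h1
      ext
      change (j : ℕ) = 3 * i + linkKind v
      omega
end

section
/- For every real number b > 0, there exists a closed polygonal chain in ℝ² with exactly 3 links containing all four points (0,0), (b,0), (0,1), (b,1); that is, the four vertices of the rectangle {0,b} × {0,1} can be covered by a closed 3-link polygonal chain. -/
/-- For every `b > 0`, the four vertices `(0,0), (b,0), (0,1), (b,1)` of the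
rectangle `{0,b} × {0,1}` can be covered by a closed polygonal chain in `ℝ²`
with exactly 3 links. -/
theorem rectangle_closed_three_link_cover (b : ℝ) (hb : 0 < b) :
    ∃ S : Fin 4 → (Fin 2 → ℝ),
      S 3 = S 0 ∧
      ∀ p ∈ ({![0, 0], ![b, 0], ![0, 1], ![b, 1]} : Set (Fin 2 → ℝ)),
        ∃ j : Fin 3, p ∈ segment ℝ (S j.castSucc) (S j.succ) := by
  refine ⟨![![0, 0], ![2 * b, 0], ![0, 2], ![0, 0]], rfl, ?_⟩
  rintro p (rfl | rfl | rfl | rfl)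
  · exact ⟨0, left_mem_segment ℝ _ _⟩
  · refine ⟨0, 1 / 2, 1 / 2, by norm_num, by norm_num, by norm_num, ?_⟩
    ext i; fin_cases i <;> simp
  · refine ⟨2, 1 / 2, 1 / 2, by norm_num, by norm_num, by norm_num, ?_⟩
    ext i; fin_cases i <;> simp [Fin.succ, Fin.castSucc]
  · refine ⟨1, 1 / 2, 1 / 2, by norm_num, by norm_num, by norm_num, ?_⟩
    ext i; fin_cases i <;> simp [Fin.succ, Fin.castSucc]
end

section
/- For every k ≥ 2, the minimum possible total number of segments in a connected union of line segments in ℝ^k covering the 2^k points of H(2,k) = {0,1}^k is strictly smaller than 3·2^{k−2} for k ≥ 3; in particular, the union of the 2^{k−1} segments joining each vertex v ∈ {0,1}^k to its antipodal vertex 1 − v (all passing through the center (1/2,…,1/2)) covers all of {0,1}^k using exactly 2^{k−1} segments, and 2^{k−1} < 3·2^{k−2}. -/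
/-- The vertex of the cube `{0,1}^(m+1)` with first coordinate `0` whose other coordinates
are given by `g`. -/
def zeroHeadVertex {m : ℕ} (g : Fin m → Bool) : Fin (m + 1) → ℝ :=
  Fin.cons 0 fun i => if g i then 1 else 0

@[simp]
theorem zeroHeadVertex_zero {m : ℕ} (g : Fin m → Bool) : zeroHeadVertex g 0 = 0 := rfl

@[simp]
theorem zeroHeadVertex_succ {m : ℕ} (g : Fin m → Bool) (i : Fin m) :
    zeroHeadVertex g i.succ = if g i then 1 else 0 := rfl

theorem zeroHeadVertex_eq_zero_or_one {m : ℕ} (g : Fin m → Bool) (i : Fin (m + 1)) :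
    zeroHeadVertex g i = 0 ∨ zeroHeadVertex g i = 1 := by
  cases i using Fin.cases with
  | zero => simp
  | succ i => cases h : g i <;> simp [h]

theorem zeroHeadVertex_injective {m : ℕ} :
    Function.Injective (zeroHeadVertex : (Fin m → Bool) → Fin (m + 1) → ℝ) := by
  intro g h hgh
  funext i
  have := congrFun hgh i.succ
  cases hg : g i <;> cases hh : h i <;> simp [hg, hh] at this ⊢

theorem exists_eq_zeroHeadVertex {m : ℕ} {w : Fin (m + 1) → ℝ} (hw : ∀ i, w i = 0 ∨ w i = 1)
    (h0 : w 0 = 0) : ∃ g, w = zeroHeadVertex g := by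
  refine ⟨fun i => decide (w i.succ = 1), funext fun i => ?_⟩
  cases i using Fin.cases with
  | zero => simp [h0]
  | succ i => rcases hw i.succ with h | h <;> simp [h]

/-- Every segment joining antipodal vertices has an endpoint with first coordinate `0`. -/
theorem exists_segment_eq_segment_zeroHeadVertex {m : ℕ} {w : Fin (m + 1) → ℝ}
    (hw : ∀ i, w i = 0 ∨ w i = 1) :
    ∃ g, segment ℝ w (fun i => 1 - w i) =
      segment ℝ (zeroHeadVertex g) (fun i => 1 - zeroHeadVertex g i) := by
  rcases hw 0 with h0 | h0
  · obtain ⟨g, rfl⟩ := exists_eq_zeroHeadVertex hw h0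
    exact ⟨g, rfl⟩
  · have hw' : ∀ i, 1 - w i = 0 ∨ 1 - w i = 1 := fun i => by
      rcases hw i with h | h <;> simp [h]
    obtain ⟨g, hg⟩ := exists_eq_zeroHeadVertex hw' (by simp [h0])
    refine ⟨g, ?_⟩
    rw [← hg, segment_symm]
    simp

theorem segment_zeroHeadVertex_injective {m : ℕ} :
    Function.Injective fun g : Fin m → Bool =>
      segment ℝ (zeroHeadVertex g) (fun i => 1 - zeroHeadVertex g i) := by
  intro g h hgh
  apply zeroHeadVertex_injective
  have hmem : zeroHeadVertex g ∈ segment ℝ (zeroHeadVertex h) (fun i => 1 - zeroHeadVertex h i) :=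
    hgh.subset (left_mem_segment ℝ _ _)
  obtain ⟨a, b, -, -, hab, he⟩ := hmem
  have hb : b = 0 := by simpa using congrFun he 0
  obtain rfl : a = 1 := by linarith
  simpa [hb] using he.symm

theorem center_mem_segment_antipodal {ι : Type*} (w : ι → ℝ) :
    (fun _ : ι => (1 : ℝ) / 2) ∈ segment ℝ w (fun i => 1 - w i) := by
  refine ⟨1 / 2, 1 / 2, by norm_num, by norm_num, by norm_num, funext fun i => ?_⟩
  simp only [Pi.add_apply, Pi.smul_apply, smul_eq_mul]
  ring

theorem isConnected_iUnion_segment_antipodal {ι κ : Type*} [Nonempty κ] (A : κ → ι → ℝ) :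
    IsConnected (⋃ j, segment ℝ (A j) (fun i => 1 - A j i)) := by
  refine ⟨⟨_, Set.mem_iUnion.2 ⟨Classical.arbitrary κ, center_mem_segment_antipodal _⟩⟩, ?_⟩
  exact isPreconnected_iUnion ⟨_, Set.mem_iInter.2 fun j => center_mem_segment_antipodal (A j)⟩
    fun j => (convex_segment _ _).isPreconnected


/-- For every `k ≥ 2`: the union of the `2^(k-1)` segments joining each vertex
`v ∈ {0,1}^k` to its antipodal vertex `1 - v` (all passing through the center
`(1/2,…,1/2)`) is a connected union of segments covering all of `{0,1}^k` and
consisting of exactly `2^(k-1)` segments, with `2^(k-1) < 3 · 2^(k-2)` for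
`k ≥ 3`; in particular, for `k ≥ 3` the minimum number of segments in a
connected union of line segments covering `{0,1}^k` is strictly smaller than
`3 · 2^(k-2)`. -/
theorem antipodal_segments_connected_cover (k : ℕ) (hk : 2 ≤ k) :
    (∀ v : Fin k → ℝ, (∀ i, v i = 0 ∨ v i = 1) →
      v ∈ ⋃ w ∈ {w : Fin k → ℝ | ∀ i, w i = 0 ∨ w i = 1},
        segment ℝ w (fun i => 1 - w i)) ∧
    (∀ w : Fin k → ℝ, (∀ i, w i = 0 ∨ w i = 1) →
      (fun _ : Fin k => (1 : ℝ) / 2) ∈ segment ℝ w (fun i => 1 - w i)) ∧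
    {s : Set (Fin k → ℝ) | ∃ w : Fin k → ℝ, (∀ i, w i = 0 ∨ w i = 1) ∧
      s = segment ℝ w (fun i => 1 - w i)}.ncard = 2 ^ (k - 1) ∧
    IsConnected (⋃ w ∈ {w : Fin k → ℝ | ∀ i, w i = 0 ∨ w i = 1},
      segment ℝ w (fun i => 1 - w i)) ∧
    (3 ≤ k → 2 ^ (k - 1) < 3 * 2 ^ (k - 2)) ∧
    (3 ≤ k → ∃ (n : ℕ) (A B : Fin n → (Fin k → ℝ)),
      n < 3 * 2 ^ (k - 2) ∧
      IsConnected (⋃ j, segment ℝ (A j) (B j)) ∧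
      ∀ v : Fin k → ℝ, (∀ i, v i = 0 ∨ v i = 1) →
        v ∈ ⋃ j, segment ℝ (A j) (B j)) := by
 
  obtain ⟨m, rfl⟩ : ∃ m, k = m + 1 := ⟨k - 1, by omega⟩
  have hlt : 3 ≤ m + 1 → 2 ^ (m + 1 - 1) < 3 * 2 ^ (m + 1 - 2) := fun h => by
    obtain ⟨l, rfl⟩ : ∃ l, m = l + 1 := ⟨m - 1, by omega⟩
    have : 0 < 2 ^ l := by positivity
    rw [show l + 1 + 1 - 1 = l + 1 by omega, show l + 1 + 1 - 2 = l by omega, pow_succ]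
    omega
  refine ⟨fun v hv => Set.mem_biUnion hv (left_mem_segment ℝ _ _),
    fun w _ => center_mem_segment_antipodal w, ?_, ?_, hlt, fun h => ?_⟩
  · have hrange : {s : Set (Fin (m + 1) → ℝ) | ∃ w : Fin (m + 1) → ℝ,
        (∀ i, w i = 0 ∨ w i = 1) ∧ s = segment ℝ w (fun i => 1 - w i)} =
        Set.range fun g : Fin m → Bool =>
          segment ℝ (zeroHeadVertex g) (fun i => 1 - zeroHeadVertex g i) := by
      ext s
      constructor
      · rintro ⟨w, hw, rfl⟩
        obtain ⟨g, hg⟩ := exists_segment_eq_segment_zeroHeadVertex hw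
        exact ⟨g, hg.symm⟩
      · rintro ⟨g, rfl⟩
        exact ⟨_, zeroHeadVertex_eq_zero_or_one g, rfl⟩
    rw [hrange, ← Set.image_univ, Set.ncard_image_of_injective _ segment_zeroHeadVertex_injective,
      Set.ncard_univ]
    simp
  · have : Nonempty {w : Fin (m + 1) → ℝ | ∀ i, w i = 0 ∨ w i = 1} := ⟨⟨0, by simp⟩⟩
    rw [Set.biUnion_eq_iUnion]
    exact isConnected_iUnion_segment_antipodal _
  · let e : Fin (2 ^ m) ≃ (Fin m → Bool) := (Fintype.equivFinOfCardEq (by simp)).symm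
    refine ⟨2 ^ m, fun j => zeroHeadVertex (e j), fun j i => 1 - zeroHeadVertex (e j) i, hlt h,
      isConnected_iUnion_segment_antipodal _, fun v hv => ?_⟩
    obtain ⟨g, hg⟩ := exists_segment_eq_segment_zeroHeadVertex hv
    refine Set.mem_iUnion.2 ⟨e.symm g, ?_⟩
    simp only [e.apply_symm_apply]
    rw [← hg]
    exact left_mem_segment ℝ _ _
end
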